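/- Let n ≥ 1 and let V = (Fin n → ℝ) × 𝔰𝔬(n), where 𝔰𝔬(n) is the space of skew-symmetric n×n real matrices, with the action of the orthogonal group O(n) given by k · (v, A) = (k v, k * A * k⁻¹). If W ⊆ V is a linear subspace invariant under this action of every k ∈ O(n), and V is the internal direct sum of W and {0} × 𝔰𝔬(n), then W = (Fin n → ℝ) × {0}. In other words, ℝⁿ is the unique O(n)-invariant complement of 𝔰𝔬(n) in ℝⁿ ⊕ 𝔰𝔬(n). (This is the fact the paper uses to define the torsion of Cartan geometries of type (ℝⁿ ⊕ 𝔰𝔬(n), O(n), Ad).) -/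

import Mathlib

open Matrix

/-- The submodule of skew-symmetric `n × n` real matrices, i.e. `𝔰𝔬(n)`. -/
def skewSubmodule (n : ℕ) : Submodule ℝ (Matrix (Fin n) (Fin n) ℝ) where
  carrier := {A | Aᵀ = -A}
  add_mem' := by
    intro a b ha hb
    simp only [Set.mem_setOf_eq] at *
    rw [transpose_add, ha, hb, neg_add]
  zero_mem' := by simp
  smul_mem' := by
    intro c a ha
    simp only [Set.mem_setOf_eq] at *
    rw [transpose_smul, ha, smul_neg]

/-- `ℝⁿ` is the unique `O(n)`-invariant complement of `𝔰𝔬(n)` in `ℝⁿ ⊕ 𝔰𝔬(n)`: if `W` is an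
`O(n)`-invariant subspace of `ℝⁿ ⊕ 𝔰𝔬(n)` such that `ℝⁿ ⊕ 𝔰𝔬(n)` is the internal direct sum of
`W` and `{0} ⊕ 𝔰𝔬(n)`, then `W = ℝⁿ ⊕ {0}`. -/
theorem unique_invariant_complement
    (n : ℕ) (hn : 1 ≤ n)
    (W : Submodule ℝ ((Fin n → ℝ) × Matrix (Fin n) (Fin n) ℝ))
    (hWV : W ≤ (⊤ : Submodule ℝ (Fin n → ℝ)).prod (skewSubmodule n))
    (hinv : ∀ k : Matrix (Fin n) (Fin n) ℝ, kᵀ * k = 1 →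
      ∀ v : Fin n → ℝ, ∀ A : Matrix (Fin n) (Fin n) ℝ,
        (v, A) ∈ W → (k.mulVec v, k * A * k⁻¹) ∈ W)
    (hinf : W ⊓ (⊥ : Submodule ℝ (Fin n → ℝ)).prod (skewSubmodule n) = ⊥)
    (hsup : W ⊔ (⊥ : Submodule ℝ (Fin n → ℝ)).prod (skewSubmodule n)
      = (⊤ : Submodule ℝ (Fin n → ℝ)).prod (skewSubmodule n)) :
    W = (⊤ : Submodule ℝ (Fin n → ℝ)).prod (⊥ : Submodule ℝ (Matrix (Fin n) (Fin n) ℝ)) := by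
  have snd_eq_zero : ∀ v A, (v, A) ∈ W → A = 0 := by
    intro v A h
    have hneg := hinv (-1) (by simp) v A h
    have hinv_neg : (-1 : Matrix (Fin n) (Fin n) ℝ)⁻¹ = -1 := inv_eq_right_inv (by simp)
    have hsum := W.add_mem h hneg
    simp only [hinv_neg, neg_mulVec, one_mulVec, neg_mul, one_mul, mul_neg, mul_one, neg_neg,
      Prod.mk_add_mk, add_neg_cancel] at hsum
    have hA : A + A ∈ skewSubmodule n := (hWV hsum).2
    have hbot : ((0 : Fin n → ℝ), A + A) ∈ W ⊓ (⊥ : Submodule ℝ (Fin n → ℝ)).prod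
        (skewSubmodule n) := ⟨hsum, rfl, hA⟩
    rw [hinf, Submodule.mem_bot, Prod.mk_eq_zero] at hbot
    ext i j
    exact add_self_eq_zero.mp (congrFun (congrFun hbot.2 i) j)
  apply le_antisymm
  · rintro ⟨v, A⟩ h
    exact ⟨trivial, snd_eq_zero v A h⟩
  · rintro ⟨v, A⟩ ⟨-, hA⟩
    obtain rfl : A = 0 := hA
    have hv : (v, (0 : Matrix (Fin n) (Fin n) ℝ)) ∈
        W ⊔ (⊥ : Submodule ℝ (Fin n → ℝ)).prod (skewSubmodule n) :=
      hsup ▸ ⟨trivial, Submodule.zero_mem _⟩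
    obtain ⟨⟨w, B⟩, hw, ⟨u, C⟩, ⟨hu, -⟩, heq⟩ := Submodule.mem_sup.mp hv
    obtain rfl : u = 0 := hu
    obtain rfl := snd_eq_zero w B hw
    obtain rfl : w = v := by simpa using congrArg Prod.fst heq
    exact hw
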